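/- arXiv:2008.02351 — 3 statements merged into one kernel-verified Lean document; each statement's English description precedes it below -/
import Mathlib

section
/- There is an absolute constant c > 0 with the following property. For every M ∈ ℕ and all real numbers σ, τ with 0 < σ ≤ 1/2 and 0 < τ ≤ 1/2, let S = {(α, γ) ∈ T² : there exist integers a, d with 1 ≤ d ≤ M, gcd(a, d) = 1, and |α − a/d| ≤ σ/M²} and let T' = {(α, γ) ∈ T² : ‖dα − γ‖ ≤ τ/M for some integer d with 1 ≤ d ≤ M}. Then Leb(S ∩ T') ≥ c·σ·τ. -/
open MeasureTheory Filter Set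

noncomputable section

/-- The torus `𝕋 = ℝ/ℤ`, equipped with its Haar (Lebesgue) probability measure `volume`. -/
abbrev 𝕋 := UnitAddCircle

/-- The increasing enumeration (0-indexed) of a set `A ⊆ ℕ`; for infinite `A`,
`enum A 0 < enum A 1 < ⋯` lists the elements of `A` in increasing order. -/
noncomputable def enum (A : Set ℕ) (n : ℕ) : ℕ := Nat.nth (· ∈ A) n

/-- `A_N`: the set of the `N` smallest elements of `A` (for `A` infinite). -/
noncomputable def firstN (A : Set ℕ) (N : ℕ) : Finset ℕ :=
  (Finset.range N).image (enum A)

/-- Additive energy `E(A) = #{(a,b,c,d) ∈ A⁴ : a + b = c + d}` of a finite set `A ⊆ ℕ`. -/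
def addE (A : Finset ℕ) : ℕ :=
  (((A ×ˢ A) ×ˢ (A ×ˢ A)).filter (fun q => q.1.1 + q.1.2 = q.2.1 + q.2.2)).card

/-- The inhomogeneous pair correlation function
`F(γ, s, N, x) = (1/N) · #{(i,j) ∈ [N]×[N] : i ≠ j, ‖x_i − x_j − γ‖ ≤ s/N}`
of a sequence `x` of points of `𝕋` (indices `0, …, N-1` playing the role of `[N]`). -/
noncomputable def Fseq (γ : 𝕋) (s : ℝ) (N : ℕ) (x : ℕ → 𝕋) : ℝ :=
  (Set.ncard {ij : ℕ × ℕ | ij.1 < N ∧ ij.2 < N ∧ ij.1 ≠ ij.2 ∧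
      ‖x ij.1 - x ij.2 - γ‖ ≤ s / N} : ℝ) / N

/-- `F(α, γ, s, N, 𝒜)`: the pair correlation function of the points `a_n α ∈ 𝕋`,
where `(a_n)` is the increasing enumeration of `A ⊆ ℕ`. -/
noncomputable def Fpc (α γ : 𝕋) (s : ℝ) (N : ℕ) (A : Set ℕ) : ℝ :=
  Fseq γ s N (fun n => (enum A n) • α)

/-- `A ⊆ ℕ` has doubly metric Poissonian pair correlations along the sequence `Nt`:
for Lebesgue-a.e. `(α, γ) ∈ 𝕋²` and every `s > 0`, `F(α, γ, s, N_t, 𝒜) → 2s`. -/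
def DMPPCAlong (A : Set ℕ) (Nt : ℕ → ℕ) : Prop :=
  ∀ᵐ p : 𝕋 × 𝕋, ∀ s : ℝ, 0 < s →
    Tendsto (fun t => Fpc p.1 p.2 s (Nt t) A) atTop (nhds (2 * s))

/-- `A ⊆ ℕ` has doubly metric Poissonian pair correlations. -/
def DMPPC (A : Set ℕ) : Prop := DMPPCAlong A id

theorem sum_totient_mul_div (M : ℕ) :
    ∑ d ∈ Finset.Icc 1 M, d.totient * (M / d) = ∑ n ∈ Finset.Icc 1 M, n := by
  calc ∑ d ∈ Finset.Icc 1 M, d.totient * (M / d)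
      = ∑ d ∈ Finset.Icc 1 M, ∑ n ∈ Finset.Icc 1 M, if d ∣ n then d.totient else 0 := by
        refine Finset.sum_congr rfl fun d _ => ?_
        rw [← Finset.sum_filter, Finset.sum_const, smul_eq_mul, mul_comm]
        congr 1
        exact (Nat.Ioc_filter_dvd_card_eq_div M d).symm
    _ = ∑ n ∈ Finset.Icc 1 M, n := by
        rw [Finset.sum_comm]
        refine Finset.sum_congr rfl fun n hn => ?_
        rw [Finset.mem_Icc] at hn
        rw [← Finset.sum_filter]
        conv_rhs => rw [← Nat.sum_totient n]
        refine Finset.sum_congr ?_ fun _ _ => rfl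
        ext d
        simp only [Finset.mem_filter, Finset.mem_Icc, Nat.mem_divisors]
        constructor
        · rintro ⟨-, h⟩
          exact ⟨h, by omega⟩
        · rintro ⟨h, -⟩
          have := Nat.le_of_dvd hn.1 h
          have := Nat.pos_of_dvd_of_pos h hn.1
          exact ⟨by omega, h⟩

theorem le_two_mul_sum_totient_div (M : ℕ) :
    (M : ℝ) ≤ 2 * ∑ d ∈ Finset.Icc 1 M, (d.totient : ℝ) / d := by
  rcases Nat.eq_zero_or_pos M with rfl | hM
  · simp
  have hM' : (0 : ℝ) < M := by exact_mod_cast hM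
  have hsum : (2 : ℝ) * ∑ n ∈ Finset.Icc 1 M, (n : ℝ) = M * (M + 1) := by
    clear hM hM'
    induction M with
    | zero => simp
    | succ k ih =>
      rw [Finset.sum_Icc_succ_top (by omega), mul_add, ih]
      push_cast
      ring
  have hle : ∑ n ∈ Finset.Icc 1 M, (n : ℝ) ≤
      M * ∑ d ∈ Finset.Icc 1 M, (d.totient : ℝ) / d := by
    have h := sum_totient_mul_div M
    rw [← Nat.cast_sum, ← h, Nat.cast_sum, Finset.mul_sum]
    refine Finset.sum_le_sum fun d _ => ?_
    rw [Nat.cast_mul]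
    calc (d.totient : ℝ) * ((M / d : ℕ) : ℝ) ≤ d.totient * ((M : ℝ) / d) := by
          gcongr
          exact Nat.cast_div_le
      _ = M * ((d.totient : ℝ) / d) := by ring
  nlinarith

theorem cube_le_sum_totient_mul_self (M : ℕ) :
    (M : ℝ) ^ 3 ≤ 64 * ∑ d ∈ Finset.Icc 1 M, (d.totient : ℝ) * d := by
  have key : ∀ d ∈ Finset.Icc 1 M, (M : ℝ) ^ 2 * ((d.totient : ℝ) / d) ≤
      16 * ((d.totient : ℝ) * d) + if 4 * d ≤ M then (M : ℝ) ^ 2 else 0 := by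
    intro d hd
    have hd0 : (0 : ℝ) < d := by exact_mod_cast (Finset.mem_Icc.1 hd).1
    have hx1 : (d.totient : ℝ) / d ≤ 1 := by
      rw [div_le_one hd0]
      exact_mod_cast Nat.totient_le d
    have hx0 : 0 ≤ (d.totient : ℝ) / d := by positivity
    have hx : (d.totient : ℝ) * d = (d : ℝ) ^ 2 * ((d.totient : ℝ) / d) := by
      field_simp
    split_ifs with h
    · have : 0 ≤ (d.totient : ℝ) * d := by positivity
      nlinarith [sq_nonneg (M : ℝ)]
    · have h' : (M : ℝ) ≤ 4 * d := by exact_mod_cast (not_le.1 h).le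
      have : (M : ℝ) ^ 2 ≤ 16 * (d : ℝ) ^ 2 := by nlinarith [Nat.cast_nonneg (α := ℝ) M]
      rw [hx]
      nlinarith
  have hcount : ∑ d ∈ Finset.Icc 1 M, (if 4 * d ≤ M then (M : ℝ) ^ 2 else 0) ≤
      (M : ℝ) / 4 * M ^ 2 := by
    rw [← Finset.sum_filter, Finset.sum_const, nsmul_eq_mul]
    gcongr
    have hsub : (Finset.Icc 1 M).filter (fun d => 4 * d ≤ M) ⊆ Finset.Icc 1 (M / 4) := by
      intro d hd
      simp only [Finset.mem_filter, Finset.mem_Icc] at hd ⊢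
      omega
    calc (((Finset.Icc 1 M).filter (fun d => 4 * d ≤ M)).card : ℝ) ≤ ((M / 4 : ℕ) : ℝ) := by
          exact_mod_cast (Finset.card_le_card hsub).trans (by simp)
      _ ≤ (M : ℝ) / 4 := by exact_mod_cast Nat.cast_div_le (α := ℝ) (m := M) (n := 4)
  have h := Finset.sum_le_sum key
  rw [← Finset.mul_sum, Finset.sum_add_distrib, ← Finset.mul_sum] at h
  nlinarith [le_two_mul_sum_totient_div M, sq_nonneg (M : ℝ)]

theorem dvd_of_norm_div_lt {m : ℤ} {D : ℕ} (hD : 0 < D)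
    (h : ‖(((m : ℝ) / (D : ℝ) : ℝ) : 𝕋)‖ < 1 / D) : (D : ℤ) ∣ m := by
  have hD' : (0 : ℝ) < D := by exact_mod_cast hD
  rw [UnitAddCircle.norm_eq] at h
  set n := round ((m : ℝ) / D)
  have h1 : |((m - n * D : ℤ) : ℝ)| < 1 := by
    have : ((m - n * D : ℤ) : ℝ) = D * ((m : ℝ) / D - n) := by
      push_cast
      field_simp
    rw [this, abs_mul, abs_of_pos hD']
    calc (D : ℝ) * |(m : ℝ) / D - n| < D * (1 / D) := by gcongr
      _ = 1 := by field_simp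
  have h2 : m - n * D = 0 := Int.abs_lt_one_iff.1 (by exact_mod_cast h1)
  exact ⟨n, by linarith⟩

theorem reduced_fraction_unique {a a' d d' : ℕ} (ha : a < d) (ha' : a' < d')
    (hc : d.Coprime a) (hc' : d'.Coprime a')
    (h : ((d * d' : ℕ) : ℤ) ∣ (a : ℤ) * d' - a' * d) : d = d' ∧ a = a' := by
  push_cast at h
  have hdvd : d ∣ d' := by
    have h1 : (d : ℤ) ∣ a * d' :=
      (dvd_sub_left (Dvd.intro_left _ rfl)).1 ((Dvd.intro _ rfl).trans h)
    exact hc.dvd_of_dvd_mul_left (by exact_mod_cast h1)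
  have hdvd' : d' ∣ d := by
    have h1 : (d' : ℤ) ∣ a' * d :=
      (dvd_sub_right (Dvd.intro_left _ rfl)).1 ((Dvd.intro_left _ rfl).trans h)
    exact hc'.dvd_of_dvd_mul_left (by exact_mod_cast h1)
  obtain rfl := Nat.dvd_antisymm hdvd hdvd'
  refine ⟨rfl, ?_⟩
  have hd : (d : ℤ) ≠ 0 := by omega
  rw [← sub_mul] at h
  have h2 : (d : ℤ) ∣ (a : ℤ) - a' := Int.dvd_of_mul_dvd_mul_right hd h
  have h3 : (a : ℤ) - a' = 0 := Int.eq_zero_of_abs_lt_dvd h2 (by rw [abs_lt]; omega)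
  omega

/-- The sheared box of points `(α, γ)` with `α` within `r` of `x` and `γ` within `s` of `k α`. -/
def shearedBox (x : 𝕋) (k : ℕ) (r s : ℝ) : Set (𝕋 × 𝕋) :=
  {p | ‖p.1 - x‖ ≤ r ∧ ‖k • p.1 - p.2‖ ≤ s}

theorem isClosed_shearedBox (x : 𝕋) (k : ℕ) (r s : ℝ) : IsClosed (shearedBox x k r s) :=
  (isClosed_le (f := fun p : 𝕋 × 𝕋 => ‖p.1 - x‖) (by fun_prop) continuous_const).inter
    (isClosed_le (f := fun p : 𝕋 × 𝕋 => ‖k • p.1 - p.2‖) (by fun_prop) continuous_const)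

theorem volume_shearedBox (x : 𝕋) (k : ℕ) {r s : ℝ} (hr0 : 0 ≤ r) (hr : 2 * r ≤ 1)
    (hs : 2 * s ≤ 1) :
    volume (shearedBox x k r s) = ENNReal.ofReal (2 * r * (2 * s)) := by
  rw [Measure.volume_eq_prod, Measure.prod_apply (isClosed_shearedBox x k r s).measurableSet]
  have hfib : ∀ α : 𝕋, volume (Prod.mk α ⁻¹' shearedBox x k r s) =
      (Metric.closedBall x r).indicator (fun _ => ENNReal.ofReal (2 * s)) α := by
    intro α
    by_cases hα : α ∈ Metric.closedBall x r
    · have : Prod.mk α ⁻¹' shearedBox x k r s = Metric.closedBall (k • α) s := by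
        ext γ
        rw [Metric.mem_closedBall, dist_eq_norm] at hα
        simp [shearedBox, hα, dist_eq_norm, norm_sub_rev γ]
      rw [this, AddCircle.volume_closedBall, min_eq_right hs, indicator_of_mem hα]
    · have : Prod.mk α ⁻¹' shearedBox x k r s = ∅ := by
        ext γ
        rw [Metric.mem_closedBall, dist_eq_norm] at hα
        simp [shearedBox, hα]
      rw [this, measure_empty, indicator_of_notMem hα]
  simp_rw [hfib]
  rw [lintegral_indicator_const Metric.isClosed_closedBall.measurableSet,
    AddCircle.volume_closedBall, min_eq_right hr, mul_comm, ← ENNReal.ofReal_mul (by linarith)]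

/-- Triples `⟨d, a, k⟩` with `a / d` a reduced fraction in `[0, 1)`, `d ≤ M` and `1 ≤ k ≤ d`. -/
def fareyTriples (M : ℕ) : Finset (Σ _ : ℕ, ℕ × ℕ) :=
  (Finset.Icc 1 M).sigma fun d => ((Finset.range d).filter d.Coprime) ×ˢ Finset.Icc 1 d

theorem mem_fareyTriples {M : ℕ} {t : Σ _ : ℕ, ℕ × ℕ} :
    t ∈ fareyTriples M ↔ (1 ≤ t.1 ∧ t.1 ≤ M) ∧ (t.2.1 < t.1 ∧ t.1.Coprime t.2.1) ∧
      1 ≤ t.2.2 ∧ t.2.2 ≤ t.1 := by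
  simp [fareyTriples]

theorem card_fareyTriples (M : ℕ) :
    (fareyTriples M).card = ∑ d ∈ Finset.Icc 1 M, d.totient * d := by
  simp [fareyTriples, Finset.card_sigma, Finset.card_product, Nat.totient_eq_card_coprime]

theorem pairwiseDisjoint_shearedBox {M : ℕ} {r s : ℝ} (hr : 4 * r * M ^ 2 ≤ 1)
    (hs : 8 * s * M ≤ 1) :
    (fareyTriples M : Set (Σ _ : ℕ, ℕ × ℕ)).PairwiseDisjoint
      fun t => shearedBox (((t.2.1 : ℝ) / t.1 : ℝ) : 𝕋) t.2.2 r s := by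
  rintro ⟨d, a, k⟩ ht ⟨d', a', k'⟩ ht' hne
  rw [Finset.mem_coe, mem_fareyTriples] at ht ht'
  dsimp only at ht ht'
  obtain ⟨⟨hd, hdM⟩, ⟨ha, hc⟩, hk, hkd⟩ := ht
  obtain ⟨⟨hd', hdM'⟩, ⟨ha', hc'⟩, hk', hkd'⟩ := ht'
  refine Set.disjoint_left.2 ?_
  rintro ⟨α, γ⟩ ⟨h1, h2⟩ ⟨h1', h2'⟩
  dsimp only at h1 h2 h1' h2'
  apply hne
  have hd0 : (0 : ℝ) < d := by exact_mod_cast hd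
  have hd0' : (0 : ℝ) < d' := by exact_mod_cast hd'
  have hdMR : (d : ℝ) ≤ M := by exact_mod_cast hdM
  have hdMR' : (d' : ℝ) ≤ M := by exact_mod_cast hdM'
  have hM : (0 : ℝ) < M := hd0.trans_le hdMR
  have hr0 : 0 ≤ r := (norm_nonneg _).trans h1
  obtain ⟨rfl, rfl⟩ : d = d' ∧ a = a' := by
    refine reduced_fraction_unique ha ha' hc hc' (dvd_of_norm_div_lt (by positivity) ?_)
    have heq : (((((a : ℤ) * d' - a' * d : ℤ) : ℝ) / ((d * d' : ℕ) : ℝ) : ℝ) : 𝕋) =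
        (α - (((a' : ℝ) / d' : ℝ) : 𝕋)) - (α - (((a : ℝ) / d : ℝ) : 𝕋)) := by
      rw [sub_sub_sub_cancel_left, ← AddCircle.coe_sub]
      congr 1
      push_cast
      field_simp
    rw [heq]
    refine (norm_sub_le _ _).trans_lt ?_
    push_cast
    rw [lt_div_iff₀ (by positivity)]
    have : (d : ℝ) * d' ≤ M ^ 2 := by nlinarith
    calc _ ≤ (r + r) * (M : ℝ) ^ 2 := by gcongr
      _ < 1 := by linarith
  have hdvd : (d : ℤ) ∣ ((k : ℤ) - k') * a := by
    refine dvd_of_norm_div_lt hd ?_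
    have heq : (((((k : ℤ) - k') * a : ℤ) : ℝ) / (d : ℝ) : ℝ) =
        ((((k : ℤ) - k' : ℤ) • ((a : ℝ) / d) : ℝ)) := by
      simp only [zsmul_eq_mul]
      push_cast
      ring
    have heq' : (((((k : ℤ) - k' : ℤ) • ((a : ℝ) / d) : ℝ)) : 𝕋) =
        ((k • α - γ) - (k' • α - γ)) - ((k : ℤ) - k') • (α - (((a : ℝ) / d : ℝ) : 𝕋)) := by
      rw [AddCircle.coe_zsmul, smul_sub, sub_sub_sub_cancel_right, sub_smul (k : ℤ) (k' : ℤ) α,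
        natCast_zsmul, natCast_zsmul]
      abel
    rw [heq, heq']
    have hkk : |(((k : ℤ) - k' : ℤ) : ℝ)| ≤ M := by
      have : |(k : ℤ) - k'| ≤ M := by rw [abs_le]; omega
      exact_mod_cast this
    have hsm : ‖((k : ℤ) - k') • (α - (((a : ℝ) / d : ℝ) : 𝕋))‖ ≤ M * r := by
      refine (norm_zsmul_le _ _).trans ?_
      rw [Int.norm_eq_abs]
      gcongr
    refine (norm_sub_le _ _).trans_lt ?_
    refine (add_le_add (norm_sub_le _ _) hsm).trans_lt ?_
    rw [lt_div_iff₀ hd0]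
    have hn : 0 ≤ s := (norm_nonneg _).trans h2
    calc _ ≤ (s + s + M * r) * (M : ℝ) := by gcongr
      _ < 1 := by nlinarith
  have hcop : IsCoprime (d : ℤ) (a : ℤ) := Nat.isCoprime_iff_coprime.2 hc
  have h0 : (k : ℤ) - k' = 0 :=
    Int.eq_zero_of_abs_lt_dvd (hcop.dvd_of_dvd_mul_right hdvd) (by rw [abs_lt]; omega)
  obtain rfl : k = k' := by omega
  rfl

/-- **Lemma (Farey measure estimate).** There is an absolute constant `c > 0` so that for every
`M ∈ ℕ` (with `M ≥ 1`) and `0 < σ, τ ≤ 1/2`, the sets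
`S = {(α,γ) : |α − a/d| ≤ σ/M² for some 1 ≤ d ≤ M, gcd(a,d) = 1}` and
`T' = {(α,γ) : ‖dα − γ‖ ≤ τ/M for some 1 ≤ d ≤ M}` satisfy `Leb(S ∩ T') ≥ c·σ·τ`. -/
theorem stmt_11 :
    ∃ c : ℝ, 0 < c ∧ ∀ M : ℕ, 1 ≤ M → ∀ σ τ : ℝ,
      0 < σ → σ ≤ 1 / 2 → 0 < τ → τ ≤ 1 / 2 →
      ENNReal.ofReal (c * σ * τ) ≤
        volume (({p : 𝕋 × 𝕋 | ∃ a : ℤ, ∃ d : ℕ, 1 ≤ d ∧ d ≤ M ∧ Int.gcd a (d : ℤ) = 1 ∧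
              ‖p.1 - (((a : ℝ) / (d : ℝ) : ℝ) : 𝕋)‖ ≤ σ / (M : ℝ) ^ 2}) ∩
          ({p : 𝕋 × 𝕋 | ∃ d : ℕ, 1 ≤ d ∧ d ≤ M ∧ ‖d • p.1 - p.2‖ ≤ τ / M})) := by
  refine ⟨1 / 128, by norm_num, fun M hM σ τ hσ hσ' hτ hτ' => ?_⟩
  have hM1 : (1 : ℝ) ≤ M := by exact_mod_cast hM
  have hM0 : (0 : ℝ) < M := by linarith
  set r : ℝ := σ / (2 * (M : ℝ) ^ 2) with hr
  set s : ℝ := τ / (4 * M) with hs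
  have hr0 : 0 < r := by positivity
  have hs0 : 0 < s := by positivity
  have hrM : r * M ^ 2 = σ / 2 := by rw [hr]; field_simp
  have hsM : s * M = τ / 4 := by rw [hs]; field_simp
  have hr1 : 2 * r ≤ 1 := by nlinarith
  have hs1 : 2 * s ≤ 1 := by nlinarith
  have hvol : ENNReal.ofReal (1 / 128 * σ * τ) ≤ volume (⋃ t ∈ fareyTriples M,
      shearedBox (((t.2.1 : ℝ) / t.1 : ℝ) : 𝕋) t.2.2 r s) := by
    rw [measure_biUnion_finset (pairwiseDisjoint_shearedBox (by linarith) (by linarith))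
      fun t _ => (isClosed_shearedBox _ _ _ _).measurableSet]
    simp_rw [volume_shearedBox _ _ hr0.le hr1 hs1]
    rw [Finset.sum_const, ← ENNReal.ofReal_nsmul, nsmul_eq_mul, card_fareyTriples]
    refine ENNReal.ofReal_le_ofReal ?_
    push_cast
    have hprod : 2 * r * (2 * s) = σ * τ / (2 * (M : ℝ) ^ 3) := by
      rw [hr, hs]
      field_simp
      ring
    rw [hprod, mul_div_assoc', le_div_iff₀ (by positivity)]
    have := mul_le_mul_of_nonneg_left (cube_le_sum_totient_mul_self M) (mul_pos hσ hτ).le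
    nlinarith [mul_pos (mul_pos hσ hτ) (pow_pos hM0 3)]
  refine hvol.trans (measure_mono (iUnion₂_subset ?_))
  rintro ⟨d, a, k⟩ ht ⟨α, γ⟩ ⟨h1, h2⟩
  obtain ⟨⟨hd, hdM⟩, ⟨-, hc⟩, hk, hkd⟩ := mem_fareyTriples.1 ht
  dsimp only at *
  refine ⟨⟨a, d, hd, hdM, ?_, ?_⟩, k, hk, hkd.trans hdM, ?_⟩
  · simpa using hc.symm
  · refine le_trans (by simpa using h1) ?_
    rw [le_div_iff₀ (by positivity)]
    linarith
  · refine h2.trans ?_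
    rw [le_div_iff₀ hM0]
    linarith
end
end

section
/- Let A ⊆ ℕ be an infinite set and A_N the set of its N smallest elements. Suppose (N_t) is a strictly increasing sequence of natural numbers such that for some constant c > 0 one has E(A_{N_t}) ≥ c·N_t³ for all sufficiently large t. Then A does not have doubly metric Poissonian pair correlations along (N_t): it is not the case that for Lebesgue-almost every (α, γ) ∈ T², F(α, γ, s, N_t, A) → 2s as t → ∞ for every s > 0. In fact, there exist s > 0 and a positive-measure set of (α, γ) ∈ T² with liminf_{t→∞} F(α, γ, s, N_t, A) < 2s. -/
open MeasureTheory Filter Set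

noncomputable section

/-- A finite set with large additive energy has few popular differences, and these account for a
positive proportion of all pairs. -/
theorem exists_popular_differences (f : ℕ → ℕ) (hf : Function.Injective f) (N : ℕ) (c : ℝ)
    (hc : 0 < c) (hN : 4 ≤ c * N)
    (hE : c * (N : ℝ) ^ 3 ≤ (addE ((Finset.range N).image f) : ℝ)) :
    ∃ D : Finset ℤ, (D.card : ℝ) * (c / 4) ≤ N ∧
      (((Finset.range N).offDiag.filter
        (fun p => (f p.1 : ℤ) - f p.2 ∉ D)).card : ℝ) ≤ (1 - c / 2) * (N : ℝ) ^ 2 := by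
  classical
  set Q := Finset.range N ×ˢ Finset.range N with hQ
  set dif : ℕ × ℕ → ℤ := fun p => (f p.1 : ℤ) - f p.2 with hdif
  set r : ℤ → ℕ := fun d => (Q.filter (fun p => dif p = d)).card with hr
  have hN0 : (0 : ℝ) < N := by
    by_contra h
    nlinarith
  have hQcard : Q.card = N * N := by simp [hQ]
  have hr_le (d : ℤ) : r d ≤ N := by
    have : (Q.filter (fun p => dif p = d)).card ≤ (Finset.range N).card := by
      apply Finset.card_le_card_of_injOn Prod.fst
      · intro p hp
        simp only [hQ, Finset.coe_filter, Finset.mem_product, mem_ofPred_eq] at hp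
        exact hp.1.1
      · intro p hp q hq h
        simp only [hdif, Finset.coe_filter, mem_ofPred_eq] at hp hq
        refine Prod.ext h (hf ?_)
        have h1 := hp.2
        have h2 := hq.2
        rw [h] at h1
        omega
    simpa using this
  have henergy : addE ((Finset.range N).image f) ≤ ∑ p ∈ Q, r (dif p) := by
    have hsig : ∑ p ∈ Q, r (dif p)
        = (Q.sigma (fun p => Q.filter (fun q => dif q = dif p))).card := by
      rw [Finset.card_sigma]
    rw [hsig, addE]
    apply Finset.card_le_card_of_surjOn
      (fun x : (Σ _ : ℕ × ℕ, ℕ × ℕ) => ((f x.1.1, f x.2.2), (f x.1.2, f x.2.1)))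
    rintro ⟨⟨a, b⟩, ⟨u, v⟩⟩ h
    simp only [Finset.coe_filter, Finset.mem_product, Finset.mem_image, mem_ofPred_eq] at h
    obtain ⟨⟨⟨⟨i, hi, rfl⟩, ⟨j, hj, rfl⟩⟩, ⟨k, hk, rfl⟩, ⟨l, hl, rfl⟩⟩, h⟩ := h
    refine ⟨⟨(i, k), (l, j)⟩, ?_, rfl⟩
    simp only [hQ, hdif, Finset.coe_sigma, Set.mem_sigma_iff, Finset.mem_coe, Finset.mem_product,
      Finset.mem_filter]
    refine ⟨⟨hi, hk⟩, ⟨hl, hj⟩, ?_⟩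
    omega
  set D : Finset ℤ := (Q.image dif).filter (fun d => c / 4 * N ≤ (r d : ℝ)) with hD
  set P := (Finset.range N).offDiag with hP
  set popular := P.filter (fun p => dif p ∈ D) with hpopular
  set rare := P.filter (fun p => dif p ∉ D) with hrare
  have hsplit : popular.card + rare.card = P.card := Finset.card_filter_add_card_filter_not _
  have hPQ : P.card + N = N * N := by
    rw [hP, Finset.offDiag_card, Finset.card_range]
    exact Nat.sub_add_cancel (Nat.le_mul_self N)
  refine ⟨D, ?_, ?_⟩
  · have h1 : ∑ d ∈ D, r d ≤ N * N := by
      rw [← hQcard, Finset.card_eq_sum_card_image dif Q]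
      exact Finset.sum_le_sum_of_subset (Finset.filter_subset _ _)
    have h2 : (D.card : ℝ) * (c / 4 * N) ≤ ∑ d ∈ D, (r d : ℝ) := by
      rw [← nsmul_eq_mul]
      exact Finset.card_nsmul_le_sum _ _ _ fun d hd => (Finset.mem_filter.1 hd).2
    have h3 : (∑ d ∈ D, (r d : ℝ)) ≤ N * N := by exact_mod_cast h1
    refine le_of_mul_le_mul_right ?_ hN0
    linarith
  · have hsum : ∑ p ∈ Q, (r (dif p) : ℝ)
        = (∑ p ∈ popular, (r (dif p) : ℝ) + ∑ p ∈ rare, (r (dif p) : ℝ))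
          + ∑ p ∈ (Finset.range N).diag, (r (dif p) : ℝ) := by
      rw [hpopular, hrare, Finset.sum_filter_add_sum_filter_not, add_comm, hP, hQ,
        ← Finset.diag_union_offDiag, Finset.sum_union (Finset.disjoint_diag_offDiag _)]
    have hpop : ∑ p ∈ popular, (r (dif p) : ℝ) ≤ popular.card * N := by
      rw [← nsmul_eq_mul]
      exact Finset.sum_le_card_nsmul _ _ _ fun p _ => by exact_mod_cast hr_le _
    have hrar : ∑ p ∈ rare, (r (dif p) : ℝ) ≤ rare.card * (c / 4 * N) := by
      rw [← nsmul_eq_mul]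
      refine Finset.sum_le_card_nsmul _ _ _ fun p hp => ?_
      have hp' := Finset.mem_filter.1 hp
      have hpQ : p ∈ Q := by
        have := Finset.mem_offDiag.1 hp'.1
        exact Finset.mem_product.2 ⟨this.1, this.2.1⟩
      by_contra! h
      exact hp'.2 (Finset.mem_filter.2 ⟨Finset.mem_image_of_mem _ hpQ, h.le⟩)
    have hdia : ∑ p ∈ (Finset.range N).diag, (r (dif p) : ℝ) ≤ N * N := by
      have : ∑ p ∈ (Finset.range N).diag, (r (dif p) : ℝ) ≤ (Finset.range N).diag.card • (N : ℝ) :=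
        Finset.sum_le_card_nsmul _ _ _ fun p _ => by exact_mod_cast hr_le _
      simpa using this
    have hE' : c * (N : ℝ) ^ 3 ≤ ∑ p ∈ Q, (r (dif p) : ℝ) := by
      refine hE.trans ?_
      exact_mod_cast henergy
    have hsplit' : (popular.card : ℝ) + rare.card + N = N * N := by
      exact_mod_cast hsplit ▸ hPQ
    have hrare_le : (rare.card : ℝ) ≤ N * N := by
      have : (0 : ℝ) ≤ popular.card := by positivity
      linarith
    have key : c * (N : ℝ) ^ 3 ≤
        popular.card * N + N * N * (c / 4 * N) + N * N := by
      have : (rare.card : ℝ) * (c / 4 * N) ≤ N * N * (c / 4 * N) := by gcongr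
      linarith
    have key2 : c / 2 * (N : ℝ) ^ 2 ≤ popular.card := by
      refine le_of_mul_le_mul_right ?_ hN0
      nlinarith [mul_le_mul_of_nonneg_right hN (mul_pos hN0 hN0).le]
    nlinarith

/-- If many pairs of points share few differences, then the pair correlation function falls
below its mean value on a set of shifts of measure bounded from below. -/
theorem exists_measurableSet_Fseq_le (x : ℕ → 𝕋) (g : ℕ × ℕ → ℤ) (y : ℤ → 𝕋)
    (hxy : ∀ i j, x i - x j = y (g (i, j))) (N : ℕ) (hN : 0 < N) (c : ℝ) (hc : 0 < c)
    (hc1 : c ≤ 1) (D : Finset ℤ) (hD : (D.card : ℝ) * (c / 4) ≤ N)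
    (hrare : (((Finset.range N).offDiag.filter (fun p => g p ∉ D)).card : ℝ)
      ≤ (1 - c / 2) * (N : ℝ) ^ 2) :
    ∃ B : Set 𝕋, MeasurableSet B ∧ ENNReal.ofReal (c / 4) ≤ volume B ∧
      ∀ γ ∈ B, Fseq γ (c ^ 2 / 64) N x ≤ 2 * (c ^ 2 / 64) * (1 - c / 8) := by
  classical
  have hprob : IsProbabilityMeasure (volume : Measure 𝕋) := ⟨by simp⟩
  set s : ℝ := c ^ 2 / 64 with hs
  have hs0 : 0 < s := by positivity
  have hN0 : (0 : ℝ) < N := by exact_mod_cast hN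
  set rare := (Finset.range N).offDiag.filter (fun p => g p ∉ D)
  set S : Set 𝕋 := ⋃ d ∈ D, Metric.closedBall (y d) (s / N) with hS
  set G : 𝕋 → ENNReal := fun γ => ∑ p ∈ rare,
    (Metric.closedBall (y (g p)) (s / N)).indicator 1 γ with hG
  have hGm : Measurable G := Finset.measurable_sum _ fun p _ =>
    measurable_one.indicator Metric.isClosed_closedBall.measurableSet
  set K : ℝ := 2 * s * (1 - c / 8) * N with hK
  have hK0 : 0 < K := by
    have : 0 < 1 - c / 8 := by linarith
    positivity
  have hSm : MeasurableSet S :=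
    Finset.measurableSet_biUnion _ fun d _ => Metric.isClosed_closedBall.measurableSet
  have hTm : MeasurableSet {γ | ENNReal.ofReal K ≤ G γ} := measurableSet_le measurable_const hGm
  have hball (z : 𝕋) : volume (Metric.closedBall z (s / N)) ≤ ENNReal.ofReal (2 * (s / N)) := by
    rw [AddCircle.volume_closedBall]
    exact ENNReal.ofReal_le_ofReal (min_le_right _ _)
  have hSvol : volume.real S ≤ c / 8 := by
    refine ENNReal.toReal_le_of_le_ofReal (by positivity) ?_
    calc volume S ≤ ∑ d ∈ D, volume (Metric.closedBall (y d) (s / N)) :=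
          measure_biUnion_finset_le _ _
      _ ≤ ∑ d ∈ D, ENNReal.ofReal (2 * (s / N)) := Finset.sum_le_sum fun d _ => hball _
      _ = ENNReal.ofReal (D.card * (2 * (s / N))) := by
          rw [Finset.sum_const, nsmul_eq_mul, ← ENNReal.ofReal_natCast,
            ← ENNReal.ofReal_mul (Nat.cast_nonneg _)]
      _ ≤ ENNReal.ofReal (c / 8) := by
          apply ENNReal.ofReal_le_ofReal
          have : (D.card : ℝ) * (2 * (s / N)) = (D.card * (c / 4)) / N * (c / 8) := by
            rw [hs]; ring
          rw [this]
          have h1 : (D.card * (c / 4)) / N ≤ 1 := (div_le_one hN0).2 hD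
          nlinarith
  have hTvol : volume.real {γ | ENNReal.ofReal K ≤ G γ} ≤ 1 - c / 2 + c / 8 := by
    have hmarkov := mul_meas_ge_le_lintegral (μ := (volume : Measure 𝕋)) hGm (ENNReal.ofReal K)
    have hint : ∫⁻ γ, G γ ≤ ENNReal.ofReal (rare.card * (2 * (s / N))) := by
      rw [hG, lintegral_finsetSum]
      · calc _ = ∑ p ∈ rare, volume (Metric.closedBall (y (g p)) (s / N)) :=
              Finset.sum_congr rfl fun p _ =>
                lintegral_indicator_one Metric.isClosed_closedBall.measurableSet
          _ ≤ ∑ p ∈ rare, ENNReal.ofReal (2 * (s / N)) := Finset.sum_le_sum fun d _ => hball _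
          _ = _ := by
            rw [Finset.sum_const, nsmul_eq_mul, ← ENNReal.ofReal_natCast,
              ← ENNReal.ofReal_mul (Nat.cast_nonneg _)]
      · exact fun p _ => measurable_one.indicator Metric.isClosed_closedBall.measurableSet
    have h1 := ENNReal.toReal_le_of_le_ofReal (by positivity) (hmarkov.trans hint)
    rw [ENNReal.toReal_mul, ENNReal.toReal_ofReal hK0.le] at h1
    change K * volume.real {γ | ENNReal.ofReal K ≤ G γ} ≤ _ at h1
    set q := volume.real {γ | ENNReal.ofReal K ≤ G γ}
    have hq1 : q ≤ 1 := measureReal_le_one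
    have h2 : (rare.card : ℝ) * (2 * (s / N)) ≤ 2 * s * N * (1 - c / 2) := by
      calc (rare.card : ℝ) * (2 * (s / N)) ≤ (1 - c / 2) * (N : ℝ) ^ 2 * (2 * (s / N)) := by gcongr
        _ = _ := by field_simp
    have h3 : (1 - c / 8) * q ≤ 1 - c / 2 := by
      have hpos : 0 < 2 * s * N := by positivity
      refine le_of_mul_le_mul_left ?_ hpos
      calc 2 * s * N * ((1 - c / 8) * q) = K * q := by rw [hK]; ring
        _ ≤ _ := h1.trans h2
    nlinarith
  refine ⟨(S ∪ {γ | ENNReal.ofReal K ≤ G γ})ᶜ, (hSm.union hTm).compl, ?_, ?_⟩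
  · apply ENNReal.ofReal_le_of_le_toReal
    change _ ≤ volume.real _
    rw [probReal_compl_eq_one_sub (hSm.union hTm)]
    have := measureReal_union_le (μ := volume) S {γ | ENNReal.ofReal K ≤ G γ}
    linarith
  · intro γ hγ
    simp only [mem_compl_iff, mem_union, not_or, mem_ofPred_eq, not_le] at hγ
    obtain ⟨hγS, hγT⟩ := hγ
    have hmem (i j : ℕ) : ‖x i - x j - γ‖ ≤ s / N ↔
        γ ∈ Metric.closedBall (y (g (i, j))) (s / N) := by
      rw [Metric.mem_closedBall', dist_eq_norm, hxy]
    have hset : {ij : ℕ × ℕ | ij.1 < N ∧ ij.2 < N ∧ ij.1 ≠ ij.2 ∧ ‖x ij.1 - x ij.2 - γ‖ ≤ s / N}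
        = (rare.filter (fun p => γ ∈ Metric.closedBall (y (g p)) (s / N)) : Finset (ℕ × ℕ)) := by
      ext ⟨i, j⟩
      simp only [mem_ofPred_eq, hmem, rare, Finset.coe_filter, Finset.mem_filter,
        Finset.mem_offDiag, Finset.mem_range]
      constructor
      · rintro ⟨hi, hj, hij, h⟩
        exact ⟨⟨⟨hi, hj, hij⟩, fun hd => hγS (Set.mem_biUnion hd h)⟩, h⟩
      · rintro ⟨⟨⟨hi, hj, hij⟩, -⟩, h⟩
        exact ⟨hi, hj, hij, h⟩
    have hGcard : G γ
        = ((rare.filter (fun p => γ ∈ Metric.closedBall (y (g p)) (s / N))).card : ENNReal) := by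
      rw [Finset.card_filter, hG]
      push_cast
      exact Finset.sum_congr rfl fun p _ => by simp only [Set.indicator_apply, Pi.one_apply]
    rw [hGcard, ← ENNReal.ofReal_natCast] at hγT
    have hlt := (ENNReal.ofReal_lt_ofReal_iff hK0).1 hγT
    rw [Fseq, hset, Set.ncard_coe_finset, div_le_iff₀ hN0]
    exact hlt.le

/-- In a finite measure space, a sequence of events of measure eventually bounded from below
occurs infinitely often with positive measure. -/
theorem measure_frequently_pos {Ω : Type*} [MeasurableSpace Ω] (μ : Measure Ω) [IsFiniteMeasure μ]
    (δ : ENNReal) (hδ : 0 < δ) (p : ℕ → Ω → Prop)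
    (h : ∀ᶠ t in atTop, ∃ B : Set Ω, MeasurableSet B ∧ δ ≤ μ B ∧ ∀ ω ∈ B, p t ω) :
    0 < μ {ω | ∃ᶠ t in atTop, p t ω} := by
  obtain ⟨n₀, hn₀⟩ := eventually_atTop.1 h
  choose! B hBm hBδ hBp using hn₀
  set U : ℕ → Set Ω := fun n => ⋃ t ≥ max n n₀, B t with hU
  have hUm (n : ℕ) : MeasurableSet (U n) :=
    MeasurableSet.biUnion (Set.to_countable _) fun t ht => hBm t (le_of_max_le_right ht)
  have hUanti : Antitone U := fun m n hmn =>
    Set.biUnion_subset_biUnion_left fun t ht => le_trans (max_le_max_right _ hmn) ht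
  have hlim := tendsto_measure_iInter_atTop (μ := μ) (fun n => (hUm n).nullMeasurableSet) hUanti
    ⟨0, measure_ne_top _ _⟩
  have hle : δ ≤ μ (⋂ n, U n) := ge_of_tendsto' hlim fun n =>
    (hBδ (max n n₀) (le_max_right _ _)).trans
      (measure_mono (Set.subset_biUnion_of_mem (u := B) (le_refl (max n n₀))))
  refine (hδ.trans_le hle).trans_le (measure_mono fun ω hω => ?_)
  refine frequently_atTop.2 fun n => ?_
  obtain ⟨t, ht, hωt⟩ := Set.mem_iUnion₂.1 (Set.mem_iInter.1 hω n)
  exact ⟨t, le_of_max_le_left ht, hBp t (le_of_max_le_right ht) ω hωt⟩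

theorem Fpc_nonneg (α γ : 𝕋) (s : ℝ) (N : ℕ) (A : Set ℕ) : 0 ≤ Fpc α γ s N A := by
  unfold Fpc Fseq
  positivity

/-- **Theorem (Bourgain, doubly metric inhomogeneous version).** If `A ⊆ ℕ` is infinite and
`(N_t)` is strictly increasing with `E(A_{N_t}) ≥ c·N_t³` for some `c > 0` and all large `t`,
then `A` does not have doubly metric Poissonian pair correlations along `(N_t)`; in fact there
are an `s > 0` and a positive-measure set of `(α, γ) ∈ 𝕋²` with
`liminf_t F(α, γ, s, N_t, 𝒜) < 2s`. -/
theorem stmt_12 (A : Set ℕ) (hA : A.Infinite) (Nt : ℕ → ℕ) (hNt : StrictMono Nt)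
    (c : ℝ) (hc : 0 < c)
    (hE : ∀ᶠ t : ℕ in atTop, c * (Nt t : ℝ) ^ 3 ≤ (addE (firstN A (Nt t)) : ℝ)) :
    ¬ DMPPCAlong A Nt ∧
      ∃ s : ℝ, 0 < s ∧ 0 < volume {p : 𝕋 × 𝕋 |
        Filter.liminf (fun t => Fpc p.1 p.2 s (Nt t) A) atTop < 2 * s} := by
  obtain ⟨b, hb0, hb1, hbc⟩ : ∃ b : ℝ, 0 < b ∧ b ≤ 1 ∧ b ≤ c :=
    ⟨min c 1, lt_min hc one_pos, min_le_right _ _, min_le_left _ _⟩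
  set s : ℝ := b ^ 2 / 64 with hs
  have hs0 : 0 < s := by positivity
  have hslice (α : 𝕋) :
      0 < volume {γ : 𝕋 | liminf (fun t => Fpc α γ s (Nt t) A) atTop < 2 * s} := by
    have hpos := measure_frequently_pos (volume : Measure 𝕋) (ENNReal.ofReal (b / 4))
      (ENNReal.ofReal_pos.2 (by positivity))
      (fun t γ => Fpc α γ s (Nt t) A ≤ 2 * s * (1 - b / 8)) ?_
    · refine hpos.trans_le (measure_mono fun γ hγ => ?_)
      have hle := liminf_le_of_frequently_le hγ
        (isBoundedUnder_of ⟨0, fun t => Fpc_nonneg α γ s (Nt t) A⟩)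
      have : 0 < s * b := by positivity
      exact hle.trans_lt (by linarith)
    · have hlarge : ∀ᶠ t in atTop, 4 / b ≤ (Nt t : ℝ) :=
        (tendsto_natCast_atTop_atTop.comp hNt.tendsto_atTop).eventually_ge_atTop _
      filter_upwards [hE, hlarge] with t hEt hNb
      have hNb' : 4 ≤ b * (Nt t : ℝ) := by
        rwa [div_le_iff₀' hb0] at hNb
      obtain ⟨D, hD, hrare⟩ := exists_popular_differences (enum A) (Nat.nth_injective hA) (Nt t) b
        hb0 hNb' (le_trans (by gcongr) hEt)
      refine exists_measurableSet_Fseq_le (fun n => enum A n • α)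
        (fun p => (enum A p.1 : ℤ) - enum A p.2) (fun d => d • α) ?_ (Nt t) ?_ b hb0 hb1 D hD hrare
      · intro i j
        simp only [sub_smul, natCast_zsmul]
      · rcases Nat.eq_zero_or_pos (Nt t) with h | h
        · rw [h] at hNb'
          norm_num at hNb'
        · exact h
  have hpos : 0 < volume {p : 𝕋 × 𝕋 |
      liminf (fun t => Fpc p.1 p.2 s (Nt t) A) atTop < 2 * s} := by
    rw [pos_iff_ne_zero]
    intro h0
    obtain ⟨α, hα⟩ := (Measure.ae_ae_of_ae_prod (measure_eq_zero_iff_ae_notMem.1 h0)).exists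
    exact (hslice α).ne' (measure_eq_zero_iff_ae_notMem.2 hα)
  refine ⟨fun hD => hpos.ne' (measure_eq_zero_iff_ae_notMem.2 ?_), s, hs0, hpos⟩
  filter_upwards [hD] with p hp
  simp [(hp s hs0).liminf_eq]
end
end

section
/- Suppose (x_n) is a sequence of points in T which is not equidistributed. Then for every ε > 0 there exists an arc I ⊆ T with Leb(I) < ε such that limsup_{N→∞} (1/N)·#{n ∈ [N] : x_n ∈ I} > Leb(I). -/
open MeasureTheory Filter Set

noncomputable section

/-- The arc of `𝕋` with left endpoint `a` and length `ℓ` (for `0 ≤ ℓ ≤ 1` it has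
Lebesgue measure `ℓ`). -/
noncomputable def arc (a ℓ : ℝ) : Set 𝕋 := (fun r : ℝ => (r : 𝕋)) '' Set.Ico a (a + ℓ)

/-- A sequence `x` of points of `𝕋` is equidistributed: for every arc `I ⊆ 𝕋`,
`(1/N)·#{n ∈ [N] : x_n ∈ I} → Leb(I)`. -/
def Equidistributed (x : ℕ → 𝕋) : Prop :=
  ∀ a ℓ : ℝ, 0 ≤ ℓ → ℓ ≤ 1 →
    Tendsto (fun N : ℕ => (Set.ncard {n : ℕ | n < N ∧ x n ∈ arc a ℓ} : ℝ) / N)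
      atTop (nhds ℓ)

/-- The proportion of the first `N` points of `x` lying in `arc a ℓ`. -/
def arcFreq (x : ℕ → 𝕋) (a ℓ : ℝ) (N : ℕ) : ℝ :=
  (Set.ncard {n : ℕ | n < N ∧ x n ∈ arc a ℓ} : ℝ) / N

theorem arc_one (a : ℝ) : arc a 1 = univ :=
  AddCircle.coe_image_Ico_eq (1 : ℝ) a

theorem arc_add (a : ℝ) {ℓ ℓ' : ℝ} (h : 0 ≤ ℓ) (h' : 0 ≤ ℓ') :
    arc a (ℓ + ℓ') = arc a ℓ ∪ arc (a + ℓ) ℓ' := by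
  unfold arc
  rw [← image_union, Ico_union_Ico_eq_Ico (by linarith) (by linarith), add_assoc]

theorem arcFreq_le_one (x : ℕ → 𝕋) (a ℓ : ℝ) (N : ℕ) : arcFreq x a ℓ N ≤ 1 := by
  refine div_le_one_of_le₀ ?_ (Nat.cast_nonneg N)
  have h : {n : ℕ | n < N ∧ x n ∈ arc a ℓ}.ncard ≤ (Set.Iio N).ncard :=
    ncard_le_ncard (fun n hn => hn.1) (finite_Iio N)
  rw [ncard_eq_toFinset_card' (Set.Iio N), toFinset_Iio, Nat.card_Iio] at h
  exact_mod_cast h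

theorem arcFreq_one (x : ℕ → 𝕋) (a : ℝ) {N : ℕ} (hN : 0 < N) : arcFreq x a 1 N = 1 := by
  have h : {n : ℕ | n < N ∧ x n ∈ arc a 1} = Set.Iio N := by
    ext n; simp [arc_one]
  have hN' : (N : ℝ) ≠ 0 := by positivity
  rw [arcFreq, h, ncard_eq_toFinset_card', toFinset_Iio, Nat.card_Iio, div_self hN']

theorem arcFreq_add_le (x : ℕ → 𝕋) (a : ℝ) {ℓ ℓ' : ℝ} (h : 0 ≤ ℓ) (h' : 0 ≤ ℓ') (N : ℕ) :
    arcFreq x a (ℓ + ℓ') N ≤ arcFreq x a ℓ N + arcFreq x (a + ℓ) ℓ' N := by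
  have hset : {n : ℕ | n < N ∧ x n ∈ arc a (ℓ + ℓ')} =
      {n : ℕ | n < N ∧ x n ∈ arc a ℓ} ∪ {n : ℕ | n < N ∧ x n ∈ arc (a + ℓ) ℓ'} := by
    ext n
    simp only [arc_add a h h', mem_ofPred_eq, mem_union]
    tauto
  unfold arcFreq
  rw [hset, ← add_div]
  gcongr
  exact_mod_cast ncard_union_le _ _

/-- Asymptotically, `arc a ℓ` contains at most its fair share of the points of `x`. -/
def ArcNotOverfull (x : ℕ → 𝕋) (a ℓ : ℝ) : Prop :=
  ∀ δ : ℝ, 0 < δ → ∀ᶠ N : ℕ in atTop, arcFreq x a ℓ N < ℓ + δ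

theorem arcNotOverfull_of_limsup_le {x : ℕ → 𝕋} {a ℓ : ℝ}
    (h : limsup (arcFreq x a ℓ) atTop ≤ ℓ) : ArcNotOverfull x a ℓ := fun δ hδ =>
  eventually_lt_of_limsup_lt (by linarith)
    (isBoundedUnder_of ⟨1, fun N => arcFreq_le_one x a ℓ N⟩)

theorem ArcNotOverfull.add {x : ℕ → 𝕋} {a ℓ ℓ' : ℝ} (h₀ : 0 ≤ ℓ) (h₀' : 0 ≤ ℓ')
    (h : ArcNotOverfull x a ℓ) (h' : ArcNotOverfull x (a + ℓ) ℓ') :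
    ArcNotOverfull x a (ℓ + ℓ') := by
  intro δ hδ
  filter_upwards [h (δ / 2) (half_pos hδ), h' (δ / 2) (half_pos hδ)] with N h₁ h₂
  have := arcFreq_add_le x a h₀ h₀' N
  linarith

theorem arcNotOverfull_of_short {x : ℕ → 𝕋} {ε : ℝ} (hε : 0 < ε)
    (h : ∀ a ℓ : ℝ, 0 ≤ ℓ → ℓ ≤ 1 → ℓ < ε → ArcNotOverfull x a ℓ)
    (a : ℝ) {ℓ : ℝ} (h₀ : 0 ≤ ℓ) (h₁ : ℓ ≤ 1) : ArcNotOverfull x a ℓ := by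
  obtain ⟨k, hk⟩ := exists_nat_one_div_lt hε
  have hk₀ : (0 : ℝ) < k + 1 := by positivity
  have hp₀ : 0 ≤ ℓ / (k + 1) := by positivity
  have hp : ℓ / (k + 1) ≤ 1 / (k + 1) := by gcongr
  have hp₁ : ℓ / (k + 1) ≤ 1 := div_le_one_of_le₀ (by linarith [k.cast_nonneg (α := ℝ)]) hk₀.le
  have key (m : ℕ) : ArcNotOverfull x a (m * (ℓ / (k + 1))) := by
    induction m with
    | zero => simpa using h a 0 le_rfl zero_le_one hε
    | succ m ih =>
      have := ih.add (by positivity) hp₀ (h _ _ hp₀ hp₁ (hp.trans_lt hk))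
      rwa [Nat.cast_succ, add_one_mul]
  have := key (k + 1)
  rwa [Nat.cast_succ, mul_div_cancel₀ _ hk₀.ne'] at this

theorem equidistributed_of_arcNotOverfull {x : ℕ → 𝕋}
    (h : ∀ a ℓ : ℝ, 0 ≤ ℓ → ℓ ≤ 1 → ArcNotOverfull x a ℓ) : Equidistributed x := by
  intro a ℓ h₀ h₁
  change Tendsto (arcFreq x a ℓ) atTop (nhds ℓ)
  rw [Metric.tendsto_nhds]
  intro δ hδ
  filter_upwards [h a ℓ h₀ h₁ δ hδ,
    h (a + ℓ) (1 - ℓ) (by linarith) (by linarith) δ hδ, eventually_gt_atTop 0] with N hu hl hN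
  have hadd := arcFreq_add_le x a h₀ (sub_nonneg.2 h₁) N
  rw [add_sub_cancel, arcFreq_one x a hN] at hadd
  rw [Real.dist_eq, abs_lt]
  constructor <;> linarith

/-- **Lemma.** If `(x_n) ⊆ 𝕋` is not equidistributed, then there are arbitrarily small arcs
`I ⊆ 𝕋` with `limsup_N (1/N)·#{n ∈ [N] : x_n ∈ I} > Leb(I)`. -/
theorem stmt_13 (x : ℕ → 𝕋) (h : ¬ Equidistributed x) :
    ∀ ε : ℝ, 0 < ε → ∃ a ℓ : ℝ, 0 ≤ ℓ ∧ ℓ ≤ 1 ∧ ℓ < ε ∧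
      ℓ < Filter.limsup
          (fun N : ℕ => (Set.ncard {n : ℕ | n < N ∧ x n ∈ arc a ℓ} : ℝ) / N) atTop := by
  intro ε hε
  by_contra! hcon
  exact h (equidistributed_of_arcNotOverfull fun a ℓ h₀ h₁ =>
    arcNotOverfull_of_short hε
      (fun a ℓ h₀ h₁ hℓ => arcNotOverfull_of_limsup_le (hcon a ℓ h₀ h₁ hℓ)) a h₀ h₁)
end
end
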